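/- If b ≥ 3 satisfies b ≡ 3 (mod 4), then the set of positive integers m such that m is a b-Niven number, m² is a b-MRH number, and s_b(m²) = s_b(m), is infinite. -/

import Mathlib

theorem ofDigits_replicate_pred (c n : ℕ) :
    Nat.ofDigits (c + 1) (List.replicate n c) + 1 = (c + 1) ^ n := by
  induction n with
  | zero => simp
  | succ n ih =>
    rw [List.replicate_succ, Nat.ofDigits_cons, pow_succ, ← ih]
    ring

theorem digits_pow_sub_one (b n : ℕ) (hb : 2 ≤ b) :
    Nat.digits b (b ^ n - 1) = List.replicate n (b - 1) := by
  obtain ⟨c, rfl⟩ : ∃ c, b = c + 1 := ⟨b - 1, by omega⟩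
  have h := ofDigits_replicate_pred c n
  rw [show (c + 1) ^ n - 1 = Nat.ofDigits (c + 1) (List.replicate n c) by omega]
  apply Nat.digits_ofDigits _ (by omega)
  · intro d hd
    have := List.eq_of_mem_replicate hd
    omega
  · intro hne
    have := List.eq_of_mem_replicate (List.getLast_mem hne)
    omega

theorem digits_pow_sub_one_sq (b n : ℕ) (hb : 3 ≤ b) :
    Nat.digits b ((b ^ (n + 1) - 1) ^ 2) =
      (1 :: List.replicate n 0) ++ ((b - 2) :: List.replicate n (b - 1)) := by
  obtain ⟨c, rfl⟩ : ∃ c, b = c + 2 := ⟨b - 2, by omega⟩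
  have h : Nat.ofDigits (c + 2) (List.replicate n (c + 1)) + 1 = (c + 2) ^ n :=
    ofDigits_replicate_pred (c + 1) n
  have hz : Nat.ofDigits (c + 2) (List.replicate n 0) = 0 := by
    induction n with
    | zero => simp
    | succ n ih => simp [List.replicate_succ, Nat.ofDigits_cons]
  have key : ((c + 2) ^ (n + 1) - 1) ^ 2 = Nat.ofDigits (c + 2)
      ((1 :: List.replicate n 0) ++ (c :: List.replicate n (c + 1))) := by
    rw [Nat.ofDigits_append, Nat.ofDigits_cons, Nat.ofDigits_cons, hz]
    simp only [List.length_cons, List.length_replicate]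
    generalize Nat.ofDigits (c + 2) (List.replicate n (c + 1)) = x at h ⊢
    rw [pow_succ (c + 2) n, ← h, show (x + 1) * (c + 2) - 1 = x * (c + 2) + c + 1 by
      rw [add_mul]; omega]
    ring
  rw [key]
  apply Nat.digits_ofDigits _ (by omega)
  · intro d hd
    simp only [List.mem_append, List.mem_cons, List.mem_replicate] at hd
    omega
  · intro hne
    rw [List.getLast_append_of_ne_nil _ (List.cons_ne_nil _ _)]
    have := List.getLast_mem (List.cons_ne_nil c (List.replicate n (c + 1)))
    simp only [List.mem_cons, List.mem_replicate] at this
    omega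

theorem two_pow_mul_sub_one_dvd (b j : ℕ) (hodd : Odd b) :
    2 ^ j * (b - 1) ∣ b ^ 2 ^ j - 1 := by
  induction j with
  | zero => simp
  | succ j ih =>
    have h2 : 2 ∣ b ^ 2 ^ j + 1 := (hodd.pow.add_odd odd_one).two_dvd
    have e : b ^ 2 ^ (j + 1) - 1 = (b ^ 2 ^ j + 1) * (b ^ 2 ^ j - 1) := by
      rw [pow_succ, pow_mul, ← Nat.sq_sub_sq, one_pow]
    rw [e, pow_succ', mul_assoc]
    exact mul_dvd_mul h2 ih

/-- If `b ≥ 3` satisfies `b ≡ 3 (mod 4)`, then the set of positive integers `m`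
such that `m` is a `b`-Niven number, `m ^ 2` is a `b`-MRH number, and
`s_b(m ^ 2) = s_b(m)`, is infinite. -/
theorem stmt_15 (b : ℕ) (hb : 3 ≤ b) (hbm : b % 4 = 3) :
    {m : ℕ | 0 < m ∧ (Nat.digits b m).sum ∣ m ∧
      (∃ M : ℕ, 0 < M ∧
        m ^ 2 = M * (Nat.digits b (m ^ 2)).sum *
          Nat.ofDigits b (Nat.digits b (M * (Nat.digits b (m ^ 2)).sum)).reverse) ∧
      (Nat.digits b (m ^ 2)).sum = (Nat.digits b m).sum}.Infinite := by
  have hodd : Odd b := Nat.odd_iff.mpr (by omega)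
  have hone (k : ℕ) : 1 ≤ b ^ k := Nat.one_le_pow _ _ (by omega)
  refine Set.infinite_of_injective_forall_mem (f := fun j : ℕ => b ^ 2 ^ j - 1) ?_ ?_
  · intro i j hij
    have hi := hone (2 ^ i)
    have hj := hone (2 ^ j)
    have h : b ^ 2 ^ i = b ^ 2 ^ j := by
      simp only at hij
      omega
    exact Nat.pow_right_injective le_rfl (Nat.pow_right_injective (by omega : 2 ≤ b) h)
  · intro j
    have hm : 0 < b ^ 2 ^ j - 1 :=
      Nat.sub_pos_of_lt (Nat.one_lt_pow (by positivity) (by omega))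
    have hdig := digits_pow_sub_one b (2 ^ j) (by omega)
    have hsum : (Nat.digits b (b ^ 2 ^ j - 1)).sum = 2 ^ j * (b - 1) := by simp [hdig]
    have hsq : (Nat.digits b ((b ^ 2 ^ j - 1) ^ 2)).sum = 2 ^ j * (b - 1) := by
      obtain ⟨n, hn⟩ : ∃ n, 2 ^ j = n + 1 := Nat.exists_eq_succ_of_ne_zero (by positivity)
      rw [hn, digits_pow_sub_one_sq b n hb]
      simp only [List.sum_append, List.sum_cons, List.sum_replicate, smul_eq_mul, mul_zero, add_mul]
      omega
    have hdvd := two_pow_mul_sub_one_dvd b j hodd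
    refine ⟨hm, hsum ▸ hdvd, ?_, hsq.trans hsum.symm⟩
    obtain ⟨M, hM⟩ := hdvd
    refine ⟨M, Nat.pos_of_ne_zero fun h0 => ?_, ?_⟩
    · rw [h0, mul_zero] at hM
      omega
    · rw [hsq, mul_comm M, ← hM, hdig, List.reverse_replicate, ← hdig, Nat.ofDigits_digits, sq]
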